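/- Under the two-level hierarchical linear regression model, for each individual child node i, the expected excess risk of the bottom-up OLS estimator satisfies E[r_i(θ̂ᵇ_i)] ≥ (s_i + p_i²) · σ² · d/(n−d−1). -/

import Mathlib

open MeasureTheory ProbabilityTheory Matrix Finset

noncomputable section

/-- The product of `d` independent standard Gaussians on `Fin d → ℝ`. -/
def stdGaussianPi (d : ℕ) : Measure (Fin d → ℝ) :=
  Measure.pi fun _ => gaussianReal 0 1

/-- `μ` is the centered multivariate Gaussian distribution on `ℝ^d` with covariance
matrix `C`, i.e. the law of `A z` where `z` is a standard Gaussian vector and `A Aᵀ = C`. -/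
def IsCenteredGaussian {d : ℕ} (μ : Measure (Fin d → ℝ))
    (C : Matrix (Fin d) (Fin d) ℝ) : Prop :=
  ∃ A : Matrix (Fin d) (Fin d) ℝ, A * Aᵀ = C ∧ μ = (stdGaussianPi d).map (fun z => A.mulVec z)

/-- Sample space for the two-level hierarchical linear regression model with `n` time steps:
a point `ω = (x, η, a)` records the covariates `x t : ℝ^d`, the noises `η t : ℝ`, and the
proportion vectors `a t : ℝ^K`, for `t = 1, …, n`. -/
abbrev HierOmega (d n K : ℕ) : Type :=
  (Fin n → (Fin d → ℝ)) × (Fin n → ℝ) × (Fin n → (Fin K → ℝ))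

/-- The joint law of the model: the covariates are i.i.d. with law `νx`, the noises are
i.i.d. with law `νη`, the proportion vectors are i.i.d. with law `νa`, and the three
families are mutually independent. -/
def hierMeasure (d n K : ℕ) (νx : Measure (Fin d → ℝ)) (νη : Measure ℝ)
    (νa : Measure (Fin K → ℝ)) : Measure (HierOmega d n K) :=
  (Measure.pi fun _ : Fin n => νx).prod
    ((Measure.pi fun _ : Fin n => νη).prod (Measure.pi fun _ : Fin n => νa))

variable {d n K : ℕ}

/-- The empirical second-moment matrix `S = ∑ t, x_t x_tᵀ`. -/
def Smat (ω : HierOmega d n K) : Matrix (Fin d) (Fin d) ℝ :=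
  ∑ t, vecMulVec (ω.1 t) (ω.1 t)

/-- The root value at time `t`: `y_{t,0} = θ₀ᵀ x_t + η_t`. -/
def yRoot (θ₀ : Fin d → ℝ) (t : Fin n) (ω : HierOmega d n K) : ℝ :=
  θ₀ ⬝ᵥ ω.1 t + ω.2.1 t

/-- The value of child `i` at time `t`: `y_{t,i} = a_{t,i} · y_{t,0}`. -/
def yChild (θ₀ : Fin d → ℝ) (i : Fin K) (t : Fin n) (ω : HierOmega d n K) : ℝ :=
  ω.2.2 t i * yRoot θ₀ t ω

/-- The bottom-up OLS estimator for child `i`: `θ̂ᵇ_i = S⁻¹ ∑ t, x_t y_{t,i}`. -/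
def thetaBU (θ₀ : Fin d → ℝ) (i : Fin K) (ω : HierOmega d n K) : Fin d → ℝ :=
  (Smat ω)⁻¹.mulVec (∑ t, yChild θ₀ i t ω • ω.1 t)

/-- The root OLS estimator `θ̂₀ = S⁻¹ ∑ t, x_t y_{t,0}`. -/
def thetaRoot (θ₀ : Fin d → ℝ) (ω : HierOmega d n K) : Fin d → ℝ :=
  (Smat ω)⁻¹.mulVec (∑ t, yRoot θ₀ t ω • ω.1 t)

/-- The estimated proportion `p̂_i = (1/n) ∑ t, a_{t,i}`. -/
def pHat (i : Fin K) (ω : HierOmega d n K) : ℝ :=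
  (∑ t, ω.2.2 t i) / n

/-- The top-down estimator for child `i`: `θ̂ᵗ_i = p̂_i θ̂₀`. -/
def thetaTD (θ₀ : Fin d → ℝ) (i : Fin K) (ω : HierOmega d n K) : Fin d → ℝ :=
  pHat i ω • thetaRoot θ₀ ω

/-- The excess risk of an estimate `est` for the target coefficient vector `tgt`,
with respect to the covariance `C`: `(est − tgt)ᵀ C (est − tgt)`. -/
def excessRisk (C : Matrix (Fin d) (Fin d) ℝ) (tgt est : Fin d → ℝ) : ℝ :=
  (est - tgt) ⬝ᵥ C.mulVec (est - tgt)


theorem lintegral_exp_neg_mul_sq_gaussianReal {b : ℝ} (hb : -(1 / 2) < b) :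
    ∫⁻ x, ENNReal.ofReal (Real.exp (-b * x ^ 2)) ∂gaussianReal 0 1 =
      ENNReal.ofReal ((1 + 2 * b) ^ (-(1 / 2) : ℝ)) := by
  have hb' : 0 < 1 + 2 * b := by linarith
  rw [gaussianReal_of_var_ne_zero _ one_ne_zero,
    lintegral_withDensity_eq_lintegral_mul _ (measurable_gaussianPDF _ _) (by fun_prop)]
  have h : ∀ x : ℝ, (gaussianPDF 0 1 * fun x => ENNReal.ofReal (Real.exp (-b * x ^ 2))) x =
      ENNReal.ofReal ((√(2 * Real.pi))⁻¹ * Real.exp (-(1 / 2 + b) * x ^ 2)) := by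
    intro x
    rw [Pi.mul_apply, gaussianPDF, ← ENNReal.ofReal_mul (gaussianPDFReal_nonneg _ _ _),
      gaussianPDFReal, mul_assoc, ← Real.exp_add]
    congr 2
    · simp
    · congr 1
      simp
      ring
  simp_rw [h]
  rw [← ofReal_integral_eq_lintegral_ofReal
    ((integrable_exp_neg_mul_sq (by linarith)).const_mul _)
    (ae_of_all _ fun x => by positivity), integral_const_mul, integral_gaussian]
  congr 1
  rw [Real.rpow_neg hb'.le, ← Real.sqrt_eq_rpow, ← Real.sqrt_inv, ← Real.sqrt_inv,
    ← Real.sqrt_mul (by positivity)]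
  congr 1
  have : (1 / 2 + b) ≠ 0 := by linarith
  field_simp

theorem lintegral_Ioi_ofReal_rpow {c : ℝ} (hc : 0 < c) {m : ℕ} (hm : 3 ≤ m) :
    ∫⁻ t in Set.Ioi (0 : ℝ), ENNReal.ofReal ((c + 2 * t) ^ (-(m / 2) : ℝ)) =
      ENNReal.ofReal (c ^ (1 - m / 2 : ℝ) / (m - 2)) := by
  have hm' : (3 : ℝ) ≤ m := by exact_mod_cast hm
  have key : ∀ t ∈ Set.Ici (0 : ℝ),
      HasDerivAt (fun t : ℝ => -((c + 2 * t) ^ (1 - m / 2 : ℝ) / (m - 2)))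
        ((c + 2 * t) ^ (-(m / 2) : ℝ)) t := by
    intro t ht
    have ht : 0 ≤ t := ht
    have h1 : HasDerivAt (fun t : ℝ => c + 2 * t) 2 t := by
      simpa using ((hasDerivAt_id t).const_mul 2).const_add c
    have h2 := ((h1.rpow_const (p := (1 - m / 2 : ℝ)) (Or.inl (by positivity))).div_const
      ((m : ℝ) - 2)).neg
    refine h2.congr_deriv ?_
    have : (m : ℝ) - 2 ≠ 0 := by linarith
    rw [show (1 - m / 2 : ℝ) - 1 = -(m / 2) by ring]
    field_simp
    ring
  have hlim : Filter.Tendsto (fun t : ℝ => -((c + 2 * t) ^ (1 - m / 2 : ℝ) / (m - 2)))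
      Filter.atTop (nhds 0) := by
    have h1 : Filter.Tendsto (fun t : ℝ => c + 2 * t) Filter.atTop Filter.atTop :=
      Filter.tendsto_atTop_add_const_left _ _
        (Filter.tendsto_id.const_mul_atTop (by norm_num))
    have h2 := (tendsto_rpow_neg_atTop (y := (m / 2 - 1 : ℝ)) (by linarith)).comp h1
    have h3 := (h2.div_const ((m : ℝ) - 2)).neg
    simpa [Function.comp_def] using h3
  have hnn : ∀ t ∈ Set.Ioi (0 : ℝ), 0 ≤ (c + 2 * t) ^ (-(m / 2) : ℝ) := by
    intro t ht
    have ht : 0 < t := ht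
    positivity
  rw [← ofReal_integral_eq_lintegral_ofReal
      (integrableOn_Ioi_deriv_of_nonneg' key hnn hlim)
      ((ae_restrict_iff' measurableSet_Ioi).2 (ae_of_all _ hnn)),
    integral_Ioi_of_hasDerivAt_of_nonneg' key hnn hlim]
  simp

theorem lintegral_Ioi_ofReal_exp_neg_mul {q : ℝ} (hq : 0 ≤ q) :
    ∫⁻ t in Set.Ioi (0 : ℝ), ENNReal.ofReal (Real.exp (-(t * q))) = (ENNReal.ofReal q)⁻¹ := by
  rcases hq.eq_or_lt with rfl | hq
  · simp
  · have hi := exp_neg_integrableOn_Ioi (0 : ℝ) hq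
    have h : ∀ t : ℝ, Real.exp (-(t * q)) = Real.exp (-q * t) := fun t => by ring_nf
    simp_rw [h]
    rw [← ofReal_integral_eq_lintegral_ofReal hi (ae_of_all _ fun x => (Real.exp_pos _).le),
      integral_exp_mul_Ioi (by linarith), ← ENNReal.ofReal_inv_of_pos hq]
    congr 1
    simp

theorem lintegral_fintype_prod_pi {ι : Type*} [Fintype ι] {X : Type*} [MeasurableSpace X]
    {μ : Measure X} [IsProbabilityMeasure μ]
    {f : ι → X → ENNReal} (hf : ∀ i, Measurable (f i)) :
    ∫⁻ x, ∏ i, f i (x i) ∂(Measure.pi fun _ : ι => μ) = ∏ i, ∫⁻ x, f i x ∂μ := by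
  refine (lintegral_prod_eq_prod_lintegral_of_indepFun Finset.univ
    (fun i (x : ι → X) => f i (x i)) (iIndepFun_pi fun i => (hf i).aemeasurable)
    (fun i => (hf i).comp (measurable_pi_apply i))).trans
    (Finset.prod_congr rfl fun i _ => ?_)
  exact (measurePreserving_eval (fun _ : ι => μ) i).lintegral_comp (hf i)

section InsertNth

variable {X : Type*} [MeasurableSpace X] {μ : Measure X} [SigmaFinite μ] {d : ℕ}

theorem lintegral_pi_eq_lintegral_lintegral_insertNth (j : Fin (d + 1))
    {f : (Fin (d + 1) → X) → ENNReal} (hf : Measurable f) :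
    ∫⁻ u, f u ∂(Measure.pi fun _ => μ) =
      ∫⁻ v, ∫⁻ z, f (j.insertNth z v) ∂μ ∂(Measure.pi fun _ => μ) := by
  have hmp := (measurePreserving_piFinSuccAbove (fun _ : Fin (d + 1) => μ) j).symm
  rw [← hmp.lintegral_comp hf]
  exact lintegral_prod_symm' _ (hf.comp hmp.measurable)

theorem ae_pi_iff_ae_ae_insertNth (j : Fin (d + 1)) {p : (Fin (d + 1) → X) → Prop}
    (hp : MeasurableSet {u | p u}) :
    (∀ᵐ u ∂(Measure.pi fun _ => μ), p u) ↔
      ∀ᵐ v ∂(Measure.pi fun _ => μ), ∀ᵐ z ∂μ, p (j.insertNth z v) := by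
  have hmp := (measurePreserving_piFinSuccAbove (fun _ : Fin (d + 1) => μ) j).symm
  have hp' := hmp.measurable hp
  rw [← hmp.map_eq]
  refine (ae_map_iff hmp.measurable.aemeasurable hp).trans ?_
  rw [← Measure.prod_swap]
  exact (ae_map_iff measurable_swap.aemeasurable hp').trans
    (Measure.ae_prod_iff_ae_ae (measurable_swap hp'))

end InsertNth

section StdGaussian

variable {E : Type*} [NormedAddCommGroup E] [InnerProductSpace ℝ E] [FiniteDimensional ℝ E]

theorem exists_orthonormalBasis_norm_starProjection_orthogonal {W : Submodule ℝ E}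
    {m k : ℕ} (hm : Module.finrank ℝ Wᗮ = m) (hk : Module.finrank ℝ W = k) :
    ∃ b : OrthonormalBasis (Fin m ⊕ Fin k) ℝ E,
      ∀ z : E, ‖Wᗮ.starProjection z‖ ^ 2 = ∑ i, inner ℝ (b (Sum.inl i)) z ^ 2 := by
  subst hm hk
  set c := stdOrthonormalBasis ℝ Wᗮ
  have hc : Orthonormal ℝ (fun i => (c i : E)) :=
    c.orthonormal.comp_linearIsometry Wᗮ.subtypeₗᵢ
  let v : Fin (Module.finrank ℝ Wᗮ) ⊕ Fin (Module.finrank ℝ W) → E :=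
    Sum.elim (fun i => (c i : E)) 0
  have hv : Orthonormal ℝ ((Set.range Sum.inl).domRestrict v) := by
    have := hc.comp _ (Equiv.ofInjective (Sum.inl :
      Fin (Module.finrank ℝ Wᗮ) → Fin (Module.finrank ℝ Wᗮ) ⊕ Fin (Module.finrank ℝ W))
      Sum.inl_injective).symm.injective
    convert this using 1
    ext1 ⟨x, i, hi⟩
    subst hi
    simp [v, Equiv.ofInjective_symm_apply]
  obtain ⟨b, hb⟩ := hv.exists_orthonormalBasis_extension_of_card_eq
    (by simp [← W.finrank_add_finrank_orthogonal, add_comm])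
  refine ⟨b, fun z => ?_⟩
  rw [Submodule.starProjection_apply, Submodule.norm_coe, ← c.sum_sq_norm_inner_right]
  refine Finset.sum_congr rfl fun i _ => ?_
  rw [hb _ ⟨i, rfl⟩]
  simp [v]

/-- A diagonal entry of the inverse Gram matrix is the inverse squared distance of the
corresponding vector to the span of the others. -/
theorem inv_gram_apply_self {d : ℕ} {u : Fin (d + 1) → E} (hu : LinearIndependent ℝ u)
    (j : Fin (d + 1)) :
    (gram ℝ u)⁻¹ j j =
      (‖(Submodule.span ℝ (Set.range (u ∘ j.succAbove)))ᗮ.starProjection (u j)‖ ^ 2)⁻¹ := by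
  set W := Submodule.span ℝ (Set.range (u ∘ j.succAbove))
  have hpd : (gram ℝ u).PosDef := posDef_gram_iff_linearIndependent.2 hu
  set g := (gram ℝ u)⁻¹ j j with hg
  have hgpos : 0 < g := hpd.inv.diag_pos
  let v : E := ∑ k, (gram ℝ u)⁻¹ k j • u k
  have hdual : ∀ l, inner ℝ (u l) v = (1 : Matrix (Fin (d + 1)) (Fin (d + 1)) ℝ) l j := fun l => by
    rw [← Matrix.mul_nonsing_inv _ ((Matrix.isUnit_iff_isUnit_det _).1 hpd.isUnit),
      Matrix.mul_apply, inner_sum]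
    simp [inner_smul_right, gram_apply, mul_comm]
  have hvW : v ∈ Wᗮ := by
    rw [Submodule.mem_orthogonal]
    intro w hw
    induction hw using Submodule.span_induction with
    | mem x hx =>
      obtain ⟨k, rfl⟩ := hx
      simp [hdual, Matrix.one_apply_ne (Fin.succAbove_ne j k)]
    | zero => simp
    | add x y _ _ hx hy => rw [inner_add_left, hx, hy, add_zero]
    | smul a x _ hx => rw [inner_smul_left, hx, mul_zero]
  have hv : v = g • Wᗮ.starProjection (u j) := by
    conv_lhs => rw [← Submodule.starProjection_eq_self_iff.2 hvW]
    simp only [v, map_sum, map_smul]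
    rw [Fin.sum_univ_succAbove _ j, Finset.sum_eq_zero, add_zero]
    intro k _
    have : u (j.succAbove k) ∈ Wᗮᗮ := by
      rw [Submodule.orthogonal_orthogonal]
      exact Submodule.subset_span ⟨k, rfl⟩
    rw [(Submodule.starProjection_apply_eq_zero_iff Wᗮ).2 this, smul_zero]
  have hvv : ‖v‖ ^ 2 = g := by
    rw [← real_inner_self_eq_norm_sq]
    nth_rw 1 [show v = ∑ k, (gram ℝ u)⁻¹ k j • u k from rfl]
    simp_rw [sum_inner, inner_smul_left, hdual]
    simp [Matrix.one_apply, hg]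
  rw [hv, norm_smul, mul_pow, Real.norm_eq_abs, sq_abs] at hvv
  have h1 : g * ‖Wᗮ.starProjection (u j)‖ ^ 2 = 1 :=
    mul_left_cancel₀ hgpos.ne' (by rw [mul_one]; linarith)
  exact eq_inv_of_mul_eq_one_left h1

variable [MeasurableSpace E] [BorelSpace E]

theorem lintegral_exp_mul_norm_sq_div_stdGaussian {W : Submodule ℝ E} {m : ℕ}
    (hW : Module.finrank ℝ Wᗮ = m) {k : ℕ} (hk : Module.finrank ℝ W = k) (hm : 3 ≤ m)
    {κ : ℝ} (hκ : κ < 1 / 2) :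
    ∫⁻ z, ENNReal.ofReal (Real.exp (κ * ‖z‖ ^ 2)) *
        (ENNReal.ofReal (‖Wᗮ.starProjection z‖ ^ 2))⁻¹ ∂stdGaussian E =
      ENNReal.ofReal ((1 - 2 * κ) ^ (-(k / 2) : ℝ)) *
        ENNReal.ofReal ((1 - 2 * κ) ^ (1 - m / 2 : ℝ) / (m - 2)) := by
  obtain ⟨b, hb⟩ := exists_orthonormalBasis_norm_starProjection_orthogonal hW hk
  have hnorm : ∀ x : Fin m ⊕ Fin k → ℝ, ‖∑ j, x j • b j‖ ^ 2 = ∑ j, x j ^ 2 := fun x => by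
    rw [← b.sum_sq_norm_inner_right]
    exact Finset.sum_congr rfl fun j _ => by
      rw [b.orthonormal.inner_right_fintype, Real.norm_eq_abs, sq_abs]
  have hproj : ∀ x : Fin m ⊕ Fin k → ℝ, ‖Wᗮ.starProjection (∑ j, x j • b j)‖ ^ 2 =
      ∑ i : Fin m, x (Sum.inl i) ^ 2 := fun x => by
    rw [hb]
    exact Finset.sum_congr rfl fun j _ => by rw [b.orthonormal.inner_right_fintype]
  let g : ℝ → Fin m ⊕ Fin k → ℝ → ENNReal := fun t j x =>
    ENNReal.ofReal (Real.exp (-(Sum.elim (fun _ => t - κ) (fun _ => -κ) j) * x ^ 2))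
  have hg : ∀ j, Measurable fun y : ℝ × ℝ => g y.1 j y.2 := by
    rintro (j | j) <;> simp only [g, Sum.elim_inl, Sum.elim_inr] <;> fun_prop
  have hpt : ∀ x : Fin m ⊕ Fin k → ℝ,
      ENNReal.ofReal (Real.exp (κ * ∑ j, x j ^ 2)) *
        (ENNReal.ofReal (∑ i : Fin m, x (Sum.inl i) ^ 2))⁻¹ =
      ∫⁻ t in Set.Ioi (0 : ℝ), ∏ j, g t j (x j) := fun x => by
    rw [← lintegral_Ioi_ofReal_exp_neg_mul (Finset.sum_nonneg fun i _ => sq_nonneg _),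
      ← lintegral_const_mul _ (by fun_prop)]
    refine lintegral_congr fun t => ?_
    rw [← ENNReal.ofReal_prod_of_nonneg (fun j _ => (Real.exp_pos _).le),
      ← ENNReal.ofReal_mul (Real.exp_pos _).le, ← Real.exp_add, ← Real.exp_sum]
    congr 2
    simp only [Fintype.sum_sum_type, Sum.elim_inl, Sum.elim_inr, ← Finset.mul_sum]
    ring
  have hint : ∀ t ∈ Set.Ioi (0 : ℝ),
      ∫⁻ x, ∏ j, g t j (x j) ∂(Measure.pi fun _ : Fin m ⊕ Fin k => gaussianReal 0 1) =
      ENNReal.ofReal ((1 - 2 * κ) ^ (-(k / 2) : ℝ)) *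
        ENNReal.ofReal ((1 - 2 * κ + 2 * t) ^ (-(m / 2) : ℝ)) := fun t ht => by
    have ht : 0 < t := ht
    rw [lintegral_fintype_prod_pi (f := g t) (fun j => (hg j).comp (by fun_prop : Measurable (Prod.mk t))),
      Fintype.prod_sum_type]
    simp only [g, Sum.elim_inl, Sum.elim_inr]
    rw [lintegral_exp_neg_mul_sq_gaussianReal (by linarith),
      lintegral_exp_neg_mul_sq_gaussianReal (by linarith)]
    simp only [Finset.prod_const, Finset.card_univ, Fintype.card_fin]
    rw [← ENNReal.ofReal_pow (Real.rpow_nonneg (by linarith) _),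
      ← ENNReal.ofReal_pow (Real.rpow_nonneg (by linarith) _), mul_comm,
      ← Real.rpow_mul_natCast (by linarith), ← Real.rpow_mul_natCast (by linarith)]
    congr 3 <;> ring
  rw [stdGaussian_eq_map_pi_orthonormalBasis b, lintegral_map (by fun_prop) (by fun_prop)]
  simp_rw [hnorm, hproj, hpt]
  have hgm : Measurable (Function.uncurry fun (x : Fin m ⊕ Fin k → ℝ) t => ∏ j, g t j (x j)) :=
    Finset.measurable_fun_prod _ fun j _ => (hg j).comp
      (by fun_prop : Measurable fun y : (Fin m ⊕ Fin k → ℝ) × ℝ => (y.2, y.1 j))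
  rw [lintegral_lintegral_swap hgm.aemeasurable, setLIntegral_congr_fun measurableSet_Ioi hint,
    lintegral_const_mul _ (by fun_prop), lintegral_Ioi_ofReal_rpow (by linarith) hm]

theorem stdGaussian_submodule {W : Submodule ℝ E} (hW : W ≠ ⊤) : stdGaussian E W = 0 := by
  obtain ⟨v, hv, hv0⟩ := Wᗮ.exists_mem_ne_zero_of_ne_bot (by
    simpa [Submodule.orthogonal_eq_bot_iff] using hW)
  have hmap := IsGaussian.map_eq_gaussianReal (μ := stdGaussian E) (innerSL ℝ v)
  rw [variance_dual_stdGaussian] at hmap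
  have hne : (‖innerSL ℝ v‖ ^ 2).toNNReal ≠ 0 := by
    simp [hv0]
  have := nullSingletonClass_gaussianReal (μ := (stdGaussian E)[innerSL ℝ v]) hne
  refine measure_mono_null (t := (innerSL ℝ v) ⁻¹' {0}) ?_ ?_
  · intro z hz
    simpa using Submodule.inner_left_of_mem_orthogonal hz hv
  · rw [← Measure.map_apply (by fun_prop) (measurableSet_singleton 0), hmap]
    exact measure_singleton 0

theorem Measurable.matrix_det {ι X : Type*} [Fintype ι] [DecidableEq ι] [MeasurableSpace X]
    {M : X → Matrix ι ι ℝ} (hM : ∀ i j, Measurable fun x => M x i j) :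
    Measurable fun x => (M x).det := by
  simp_rw [Matrix.det_apply]
  exact Finset.measurable_fun_sum _ fun σ _ =>
    (Finset.measurable_fun_prod _ fun i _ => hM _ _).const_smul _

theorem Measurable.matrix_inv_apply {ι X : Type*} [Fintype ι] [DecidableEq ι] [MeasurableSpace X]
    {M : X → Matrix ι ι ℝ} (hM : ∀ i j, Measurable fun x => M x i j) (i j : ι) :
    Measurable fun x => (M x)⁻¹ i j := by
  simp_rw [Matrix.inv_def, Ring.inverse_eq_inv', Matrix.smul_apply, smul_eq_mul,
    Matrix.adjugate_apply]
  refine (Measurable.matrix_det hM).inv.mul (Measurable.matrix_det fun k l => ?_)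
  by_cases hk : k = j
  · subst hk
    simp
  · simpa [Matrix.updateRow_ne hk] using hM k l

theorem ae_linearIndependent_stdGaussian {d : ℕ} (hd : d ≤ Module.finrank ℝ E) :
    ∀ᵐ u ∂Measure.pi fun _ : Fin d => stdGaussian E, LinearIndependent ℝ u := by
  induction d with
  | zero => exact ae_of_all _ fun u => linearIndependent_empty_type
  | succ d ih =>
    refine (ae_pi_iff_ae_ae_insertNth (p := fun u => LinearIndependent ℝ u) 0
      isOpen_setOfPred_linearIndependent.measurableSet).2 ?_
    filter_upwards [ih (by lia)] with V hV
    have hW : Submodule.span ℝ (Set.range V) ≠ ⊤ := by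
      intro h
      have := finrank_span_eq_card hV
      rw [h, finrank_top, Fintype.card_fin] at this
      lia
    filter_upwards [measure_eq_zero_iff_ae_notMem.1 (stdGaussian_submodule hW)] with z hz
    rw [Fin.insertNth_zero']
    exact linearIndependent_finCons.2 ⟨hV, hz⟩

theorem lintegral_exp_mul_norm_sq_stdGaussian_ne_top {κ : ℝ} (hκ : κ < 1 / 2) :
    ∫⁻ z, ENNReal.ofReal (Real.exp (κ * ‖z‖ ^ 2)) ∂stdGaussian E ≠ ⊤ := by
  set b := stdOrthonormalBasis ℝ E
  have hnorm : ∀ x : Fin (Module.finrank ℝ E) → ℝ,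
      ENNReal.ofReal (Real.exp (κ * ‖∑ j, x j • b j‖ ^ 2)) =
        ∏ j, ENNReal.ofReal (Real.exp (-(-κ) * x j ^ 2)) := fun x => by
    rw [← b.sum_sq_norm_inner_right,
      ← ENNReal.ofReal_prod_of_nonneg (fun j _ => (Real.exp_pos _).le), ← Real.exp_sum,
      Finset.mul_sum]
    congr 2
    exact Finset.sum_congr rfl fun j _ => by
      rw [b.orthonormal.inner_right_fintype, Real.norm_eq_abs, sq_abs, neg_neg]
  rw [stdGaussian_eq_map_pi_orthonormalBasis b, lintegral_map (by fun_prop) (by fun_prop)]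
  simp_rw [hnorm]
  rw [lintegral_fintype_prod_pi
      (f := fun _ y => ENNReal.ofReal (Real.exp (-(-κ) * y ^ 2))) (fun j => by fun_prop),
    lintegral_exp_neg_mul_sq_gaussianReal (by linarith)]
  exact ENNReal.prod_ne_top fun _ _ => ENNReal.ofReal_ne_top

theorem lintegral_exp_mul_sum_norm_sq_stdGaussian_ne_top {ι : Type*} [Fintype ι] {κ : ℝ}
    (hκ : κ < 1 / 2) :
    ∫⁻ u, ENNReal.ofReal (Real.exp (κ * ∑ k, ‖u k‖ ^ 2))
      ∂(Measure.pi fun _ : ι => stdGaussian E) ≠ ⊤ := by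
  have h : ∀ u : ι → E, ENNReal.ofReal (Real.exp (κ * ∑ k, ‖u k‖ ^ 2)) =
      ∏ k, ENNReal.ofReal (Real.exp (κ * ‖u k‖ ^ 2)) := fun u => by
    rw [← ENNReal.ofReal_prod_of_nonneg (fun j _ => (Real.exp_pos _).le), ← Real.exp_sum,
      Finset.mul_sum]
  simp_rw [h]
  rw [lintegral_fintype_prod_pi
    (f := fun _ (y : E) => ENNReal.ofReal (Real.exp (κ * ‖y‖ ^ 2))) (fun j => by fun_prop)]
  exact ENNReal.prod_ne_top fun _ _ => lintegral_exp_mul_norm_sq_stdGaussian_ne_top hκ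

theorem measurable_inv_gram_apply {ι : Type*} [Fintype ι] [DecidableEq ι] (i j : ι) :
    Measurable fun u : ι → E => (gram ℝ u)⁻¹ i j :=
  Measurable.matrix_inv_apply (fun k l => by simp only [gram_apply]; fun_prop) i j

theorem lintegral_exp_mul_inv_gram_stdGaussian {d m : ℕ} (hdm : Module.finrank ℝ E = d + m)
    (hm : 3 ≤ m) {κ : ℝ} (hκ : κ < 1 / 2) (j : Fin (d + 1)) :
    ∫⁻ u, ENNReal.ofReal (Real.exp (κ * ∑ k, ‖u k‖ ^ 2)) * ENNReal.ofReal ((gram ℝ u)⁻¹ j j)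
        ∂(Measure.pi fun _ : Fin (d + 1) => stdGaussian E) =
      (∫⁻ v, ENNReal.ofReal (Real.exp (κ * ∑ k, ‖v k‖ ^ 2))
        ∂(Measure.pi fun _ : Fin d => stdGaussian E)) *
      (ENNReal.ofReal ((1 - 2 * κ) ^ (-(d / 2) : ℝ)) *
        ENNReal.ofReal ((1 - 2 * κ) ^ (1 - m / 2 : ℝ) / (m - 2))) := by
  have hF : Measurable fun u : Fin (d + 1) → E =>
      ENNReal.ofReal (Real.exp (κ * ∑ k, ‖u k‖ ^ 2)) * ENNReal.ofReal ((gram ℝ u)⁻¹ j j) :=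
    Measurable.mul (by fun_prop) (measurable_inv_gram_apply j j).ennreal_ofReal
  have hli := (ae_pi_iff_ae_ae_insertNth (p := fun u => LinearIndependent ℝ u) j
    isOpen_setOfPred_linearIndependent.measurableSet).1
    (ae_linearIndependent_stdGaussian (E := E) (d := d + 1) (by lia))
  rw [lintegral_pi_eq_lintegral_lintegral_insertNth j hF,
    ← lintegral_mul_const _ (by fun_prop)]
  refine lintegral_congr_ae ?_
  filter_upwards [hli, ae_linearIndependent_stdGaussian (E := E) (d := d) (by lia)] with v hv hvli
  set W := Submodule.span ℝ (Set.range v)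
  have hWd : Module.finrank ℝ W = d := by
    simpa using finrank_span_eq_card hvli
  have hWm : Module.finrank ℝ Wᗮ = m := by
    have := W.finrank_add_finrank_orthogonal
    lia
  rw [← lintegral_exp_mul_norm_sq_div_stdGaussian hWm hWd hm hκ,
    ← lintegral_const_mul _ (by fun_prop)]
  refine lintegral_congr_ae ?_
  filter_upwards [hv] with z hz
  have hcomp : (j.insertNth z v : Fin (d + 1) → E) ∘ j.succAbove = v := by
    ext k
    simp
  have hpos : 0 < ‖Wᗮ.starProjection z‖ ^ 2 := by
    have h : 0 < (gram ℝ (j.insertNth z v : Fin (d + 1) → E))⁻¹ j j :=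
      (posDef_gram_iff_linearIndependent.2 hz).inv.diag_pos
    rw [inv_gram_apply_self hz, hcomp, Fin.insertNth_apply_same] at h
    exact inv_pos.1 h
  rw [inv_gram_apply_self hz, hcomp, Fin.insertNth_apply_same, Fin.sum_univ_succAbove _ j]
  simp only [Fin.insertNth_apply_same, Fin.insertNth_apply_succAbove]
  rw [ENNReal.ofReal_inv_of_pos hpos, mul_add, Real.exp_add, ENNReal.ofReal_mul (Real.exp_pos _).le]
  ring

end StdGaussian

theorem map_swap_pi_pi {ι κ X : Type*} [Fintype ι] [Fintype κ] [MeasurableSpace X]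
    (μ : Measure X) [IsProbabilityMeasure μ] :
    (Measure.pi fun _ : ι => Measure.pi fun _ : κ => μ).map (fun Z j t => Z t j) =
      Measure.pi fun _ : κ => Measure.pi fun _ : ι => μ := by
  refine (Measure.pi_eq_generateFrom (fun _ => generateFrom_pi) (fun _ => isPiSystem_pi)
    (fun _ => ⟨fun _ => Set.univ, fun _ => ⟨fun _ => Set.univ, by simp, by simp⟩,
      fun _ => measure_lt_top _ _, Set.iUnion_const _⟩) fun s hs => ?_).symm
  choose r hr hrs using hs
  obtain rfl : (fun j => Set.pi Set.univ (r j)) = s := funext hrs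
  have hr' : ∀ j t, MeasurableSet (r j t) := fun j t => hr j t trivial
  rw [Measure.map_apply (by fun_prop)
    (MeasurableSet.univ_pi fun j => MeasurableSet.univ_pi (hr' j))]
  have h : (fun (Z : ι → κ → X) j t => Z t j) ⁻¹'
      (Set.pi Set.univ fun j => Set.pi Set.univ (r j)) =
      Set.pi Set.univ fun t => Set.pi Set.univ fun j => r j t := by
    ext Z
    simp only [Set.mem_preimage, Set.mem_pi, Set.mem_univ, true_imp_iff]
    exact forall_comm
  rw [h]
  simp_rw [Measure.pi_pi]
  exact Finset.prod_comm

instance : IsProbabilityMeasure (stdGaussianPi d) :=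
  inferInstanceAs (IsProbabilityMeasure (Measure.pi fun _ => gaussianReal 0 1))

theorem map_columns_pi_stdGaussianPi (d n : ℕ) :
    (Measure.pi fun _ : Fin n => stdGaussianPi d).map
        (fun Z j => WithLp.toLp 2 fun t => Z t j) =
      Measure.pi fun _ : Fin d => stdGaussian (EuclideanSpace ℝ (Fin n)) := by
  have h := Measure.pi_map_pi (ι := Fin d)
    (μ := fun _ => Measure.pi fun _ : Fin n => gaussianReal 0 1)
    (f := fun _ => WithLp.toLp 2) (fun _ => by fun_prop)
  simp_rw [map_pi_eq_stdGaussian] at h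
  rw [← h, ← map_swap_pi_pi, Measure.map_map (by fun_prop) (by fun_prop)]
  rfl

theorem sum_vecMulVec_eq_gram (Z : Fin n → Fin d → ℝ) :
    ∑ t, vecMulVec (Z t) (Z t) =
      gram ℝ fun j => (WithLp.toLp 2 fun t => Z t j : EuclideanSpace ℝ (Fin n)) := by
  ext j k
  simp [Matrix.sum_apply, vecMulVec_apply, gram_apply, PiLp.inner_apply, mul_comm]

theorem ae_posDef_sum_vecMulVec (h : d ≤ n) :
    ∀ᵐ Z ∂Measure.pi fun _ : Fin n => stdGaussianPi d,
      (∑ t, vecMulVec (Z t) (Z t)).PosDef := by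
  have hli := ae_linearIndependent_stdGaussian (E := EuclideanSpace ℝ (Fin n)) (d := d) (by simpa)
  rw [← map_columns_pi_stdGaussianPi] at hli
  filter_upwards [ae_of_ae_map (Measurable.aemeasurable (by fun_prop)) hli] with Z hZ
  rw [sum_vecMulVec_eq_gram]
  exact posDef_gram_iff_linearIndependent.2 hZ

theorem lintegral_exp_mul_inv_sum_vecMulVec (κ : ℝ) (j : Fin d) :
    ∫⁻ Z, ENNReal.ofReal (Real.exp (κ * ∑ k, ∑ t, Z t k ^ 2)) *
        ENNReal.ofReal ((∑ t, vecMulVec (Z t) (Z t))⁻¹ j j)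
        ∂(Measure.pi fun _ : Fin n => stdGaussianPi d) =
      ∫⁻ u, ENNReal.ofReal (Real.exp (κ * ∑ k, ‖u k‖ ^ 2)) * ENNReal.ofReal ((gram ℝ u)⁻¹ j j)
        ∂(Measure.pi fun _ : Fin d => stdGaussian (EuclideanSpace ℝ (Fin n))) := by
  have hF : Measurable fun u : Fin d → EuclideanSpace ℝ (Fin n) =>
      ENNReal.ofReal (Real.exp (κ * ∑ k, ‖u k‖ ^ 2)) * ENNReal.ofReal ((gram ℝ u)⁻¹ j j) :=
    Measurable.mul (by fun_prop) (measurable_inv_gram_apply j j).ennreal_ofReal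
  rw [← map_columns_pi_stdGaussianPi, lintegral_map hF (by fun_prop)]
  simp_rw [sum_vecMulVec_eq_gram, EuclideanSpace.norm_sq_eq, Real.norm_eq_abs, sq_abs]

theorem measurable_inv_sum_vecMulVec_apply (j k : Fin d) :
    Measurable fun Z : Fin n → Fin d → ℝ => (∑ t, vecMulVec (Z t) (Z t))⁻¹ j k :=
  Measurable.matrix_inv_apply
    (fun k l => by simp only [Matrix.sum_apply, vecMulVec_apply]; fun_prop) j k

theorem lintegral_inv_sum_vecMulVec (h : d + 2 ≤ n) (j : Fin d) :
    ∫⁻ Z, ENNReal.ofReal ((∑ t, vecMulVec (Z t) (Z t))⁻¹ j j)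
        ∂(Measure.pi fun _ : Fin n => stdGaussianPi d) =
      ENNReal.ofReal (1 / ((n : ℝ) - d - 1)) := by
  have h0 := lintegral_exp_mul_inv_sum_vecMulVec (n := n) 0 j
  obtain _ | d := d
  · exact j.elim0
  obtain ⟨m, rfl⟩ : ∃ m, n = d + m := ⟨n - d, by lia⟩
  rw [lintegral_exp_mul_inv_gram_stdGaussian (m := m) (by simp) (by lia) (by norm_num)] at h0
  simp only [zero_mul, Real.exp_zero, ENNReal.ofReal_one, one_mul, mul_zero, sub_zero,
    Real.one_rpow, lintegral_const, measure_univ] at h0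
  rw [h0]
  push_cast
  ring_nf

theorem lintegral_exp_mul_inv_sum_vecMulVec_ne_top (h : d + 2 ≤ n) {κ : ℝ} (hκ : κ < 1 / 2)
    (j : Fin d) :
    ∫⁻ Z, ENNReal.ofReal (Real.exp (κ * ∑ k, ∑ t, Z t k ^ 2)) *
        ENNReal.ofReal ((∑ t, vecMulVec (Z t) (Z t))⁻¹ j j)
        ∂(Measure.pi fun _ : Fin n => stdGaussianPi d) ≠ ⊤ := by
  rw [lintegral_exp_mul_inv_sum_vecMulVec]
  obtain _ | d := d
  · exact j.elim0
  rw [lintegral_exp_mul_inv_gram_stdGaussian (m := n - d) (by simp; lia) (by lia) hκ]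
  exact ENNReal.mul_ne_top (lintegral_exp_mul_sum_norm_sq_stdGaussian_ne_top hκ)
    (ENNReal.mul_ne_top ENNReal.ofReal_ne_top ENNReal.ofReal_ne_top)

theorem integrable_exp_mul_trace_inv_sum_vecMulVec (h : d + 2 ≤ n) {κ : ℝ} (hκ : κ < 1 / 2) :
    Integrable (fun Z : Fin n → Fin d → ℝ => Real.exp (κ * ∑ k, ∑ t, Z t k ^ 2) *
      (∑ t, vecMulVec (Z t) (Z t))⁻¹.trace) (Measure.pi fun _ => stdGaussianPi d) := by
  have hsum : ∀ Z : Fin n → Fin d → ℝ, Real.exp (κ * ∑ k, ∑ t, Z t k ^ 2) *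
      (∑ t, vecMulVec (Z t) (Z t))⁻¹.trace =
      ∑ j, Real.exp (κ * ∑ k, ∑ t, Z t k ^ 2) * (∑ t, vecMulVec (Z t) (Z t))⁻¹ j j :=
    fun Z => Finset.mul_sum _ _ _
  simp_rw [hsum]
  refine integrable_finsetSum _ fun j _ => ?_
  refine (lintegral_ofReal_ne_top_iff_integrable (Measurable.mul (by fun_prop)
    (measurable_inv_sum_vecMulVec_apply j j)).aestronglyMeasurable ?_).1 ?_
  · filter_upwards [ae_posDef_sum_vecMulVec (by lia)] with Z hZ
    exact mul_nonneg (Real.exp_pos _).le hZ.inv.diag_pos.le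
  · exact ne_of_eq_of_ne (lintegral_congr fun Z => ENNReal.ofReal_mul (Real.exp_pos _).le)
      (lintegral_exp_mul_inv_sum_vecMulVec_ne_top h hκ j)

theorem integral_trace_inv_sum_vecMulVec (h : d + 2 ≤ n) :
    ∫ Z, (∑ t, vecMulVec (Z t) (Z t))⁻¹.trace
      ∂(Measure.pi fun _ : Fin n => stdGaussianPi d) = d / ((n : ℝ) - d - 1) := by
  have hpos : (0 : ℝ) ≤ 1 / ((n : ℝ) - d - 1) := by
    have : (d + 2 : ℝ) ≤ n := by exact_mod_cast h
    exact one_div_nonneg.2 (by linarith)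
  have hnn : ∀ j : Fin d, ∀ᵐ Z ∂Measure.pi fun _ : Fin n => stdGaussianPi d,
      0 ≤ (∑ t, vecMulVec (Z t) (Z t))⁻¹ j j := fun j => by
    filter_upwards [ae_posDef_sum_vecMulVec (by lia)] with Z hZ using hZ.inv.diag_pos.le
  have hm : ∀ j : Fin d, AEStronglyMeasurable
      (fun Z : Fin n → Fin d → ℝ => (∑ t, vecMulVec (Z t) (Z t))⁻¹ j j)
      (Measure.pi fun _ => stdGaussianPi d) :=
    fun j => (measurable_inv_sum_vecMulVec_apply j j).aestronglyMeasurable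
  simp_rw [Matrix.trace, Matrix.diag]
  rw [integral_finsetSum _ fun j _ =>
    (lintegral_ofReal_ne_top_iff_integrable (hm j) (hnn j)).1 ?_]
  · simp_rw [fun j => integral_eq_lintegral_of_nonneg_ae (hnn j) (hm j),
      lintegral_inv_sum_vecMulVec h, ENNReal.toReal_ofReal hpos]
    simp [div_eq_mul_inv]
  · rw [lintegral_inv_sum_vecMulVec h]
    exact ENNReal.ofReal_ne_top

section Product

variable {Ω X A ι : Type*} [MeasurableSpace Ω] [MeasurableSpace X] [MeasurableSpace A] [Fintype ι]

theorem integrable_mul_mul_prod {Y : Type*} [MeasurableSpace Y] {ζ : Measure Ω} {ν : Measure X}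
    {ρ : Measure Y} [SFinite ζ] [SFinite ν] [SFinite ρ] {f : Ω → ℝ} {g : X → ℝ} {h : Y → ℝ}
    (hf : Integrable f ζ) (hg : Integrable g ν) (hh : Integrable h ρ) :
    Integrable (fun ω : Ω × X × Y => f ω.1 * (g ω.2.1 * h ω.2.2)) (ζ.prod (ν.prod ρ)) :=
  hf.mul_prod (hg.mul_prod hh)

theorem integral_mul_mul_prod {Y : Type*} [MeasurableSpace Y] {ζ : Measure Ω} {ν : Measure X}
    {ρ : Measure Y} [SFinite ζ] [SFinite ν] [SFinite ρ] (f : Ω → ℝ) (g : X → ℝ) (h : Y → ℝ) :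
    ∫ ω : Ω × X × Y, f ω.1 * (g ω.2.1 * h ω.2.2) ∂ζ.prod (ν.prod ρ) =
      (∫ x, f x ∂ζ) * ((∫ x, g x ∂ν) * ∫ y, h y ∂ρ) := by
  rw [integral_prod_mul f (fun y : X × Y => g y.1 * h y.2), integral_prod_mul]

theorem integrable_eval_mul_eval {ν : Measure X} [IsProbabilityMeasure ν] {f g : X → ℝ}
    (hf : MemLp f 2 ν) (hg : MemLp g 2 ν) (s t : ι) :
    Integrable (fun x : ι → X => f (x s) * g (x t)) (Measure.pi fun _ => ν) :=
  (hf.comp_measurePreserving (measurePreserving_eval (fun _ : ι => ν) s)).integrable_mul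
    (hg.comp_measurePreserving (measurePreserving_eval (fun _ : ι => ν) t))

theorem integral_sq_eq_integral_sub_sq_add {ν : Measure X} [IsProbabilityMeasure ν] {f : X → ℝ}
    {q : ℝ} (hf : MemLp f 2 ν) (hq : ∫ x, f x ∂ν = q) :
    ∫ x, f x ^ 2 ∂ν = ∫ x, (f x - q) ^ 2 ∂ν + q ^ 2 := by
  have hsub : Integrable (fun x => (f x - q) ^ 2) ν := (hf.sub (memLp_const q)).integrable_sq
  have hmul : Integrable (fun x => 2 * q * f x) ν := (hf.integrable one_le_two).const_mul _
  have hlin : Integrable (fun x => 2 * q * f x - q ^ 2) ν := hmul.sub (integrable_const _)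
  have hsum : ∀ x, f x ^ 2 = (f x - q) ^ 2 + (2 * q * f x - q ^ 2) := fun x => by ring
  rw [integral_congr_ae (ae_of_all _ hsum), integral_add hsub hlin,
    integral_sub hmul (integrable_const _), integral_const_mul, hq, integral_const,
    probReal_univ, one_smul]
  ring

theorem integral_eval_mul_eval [DecidableEq ι] {ν : Measure ℝ} [IsProbabilityMeasure ν]
    (h0 : ∫ e, e ∂ν = 0) (s t : ι) :
    ∫ e : ι → ℝ, e s * e t ∂(Measure.pi fun _ => ν) = if s = t then ∫ e, e ^ 2 ∂ν else 0 := by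
  split_ifs with h
  · subst h
    simp_rw [← sq]
    exact integral_comp_eval (μ := fun _ : ι => ν) (i := s) (f := fun e : ℝ => e ^ 2) (by fun_prop)
  · have hind := (iIndepFun_pi (μ := fun _ : ι => ν) (X := fun _ e => e)
      fun _ => by fun_prop).indepFun h
    rw [hind.integral_fun_mul_eq_mul_integral (measurable_pi_apply s).aestronglyMeasurable
      (measurable_pi_apply t).aestronglyMeasurable]
    have := integral_comp_eval (μ := fun _ : ι => ν) (i := s) (f := fun e : ℝ => e) (by fun_prop)
    rw [this, h0, zero_mul]

variable {ζ : Measure Ω} [IsProbabilityMeasure ζ] {ν : Measure ℝ} [IsProbabilityMeasure ν]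
  {ρ : Measure A} [IsProbabilityMeasure ρ] {α : A → ℝ} {p : ℝ} {b : ι → Ω → ℝ}
  {k : ι → ι → Ω → ℝ}

/-- Second moment of a random linear combination with weights `(α - p) b + α e`, where the noise
`e` is centered and independent of the other variables: it is integrable and bounded below by the
contribution of the noise. -/
theorem integrable_and_le_integral_quadratic_form
    (hk : ∀ s t, Integrable (k s t) ζ) (hbk : ∀ r s t, Integrable (fun z => b r z * k s t z) ζ)
    (hbbk : ∀ s t, Integrable (fun z => b s z * b t z * k s t z) ζ)
    (hpsd : ∀ z (c : ι → ℝ), 0 ≤ ∑ s, ∑ t, c s * c t * k s t z)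
    (hν : MemLp (fun e : ℝ => e) 2 ν) (h0 : ∫ e, e ∂ν = 0) (hα : MemLp α 2 ρ) :
    let w : ι → Ω × (ι → ℝ) × (ι → A) → ℝ :=
      fun t ω => (α (ω.2.2 t) - p) * b t ω.1 + α (ω.2.2 t) * ω.2.1 t
    let μ := ζ.prod ((Measure.pi fun _ : ι => ν).prod (Measure.pi fun _ : ι => ρ))
    Integrable (fun ω => ∑ s, ∑ t, w s ω * w t ω * k s t ω.1) μ ∧
      (∫ a, α a ^ 2 ∂ρ) * (∫ e, e ^ 2 ∂ν) * ∑ t, ∫ z, k t t z ∂ζ ≤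
        ∫ ω, ∑ s, ∑ t, w s ω * w t ω * k s t ω.1 ∂μ := by
  classical
  intro w μ
  have hαp : MemLp (fun a => α a - p) 2 ρ := hα.sub (memLp_const p)
  have hνs : ∀ s, Integrable (fun e : ι → ℝ => e s) (Measure.pi fun _ : ι => ν) := fun s =>
    integrable_comp_eval (μ := fun _ : ι => ν) (i := s) (f := fun e : ℝ => e)
      (hν.integrable one_le_two)
  have hνs0 : ∀ s, ∫ e : ι → ℝ, e s ∂(Measure.pi fun _ : ι => ν) = 0 := fun s => by
    rw [← h0]
    exact integral_comp_eval (μ := fun _ : ι => ν) (i := s) (f := fun e : ℝ => e) (by fun_prop)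
  let U : ι → ι → Ω × (ι → ℝ) × (ι → A) → ℝ := fun s t ω =>
    (b s ω.1 * b t ω.1 * k s t ω.1) * (1 * ((α (ω.2.2 s) - p) * (α (ω.2.2 t) - p)))
  let V : ι → ι → Ω × (ι → ℝ) × (ι → A) → ℝ := fun s t ω =>
    (b s ω.1 * k s t ω.1) * (ω.2.1 t * ((α (ω.2.2 s) - p) * α (ω.2.2 t)))
  let V' : ι → ι → Ω × (ι → ℝ) × (ι → A) → ℝ := fun s t ω =>
    (b t ω.1 * k s t ω.1) * (ω.2.1 s * (α (ω.2.2 s) * (α (ω.2.2 t) - p)))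
  let W : ι → ι → Ω × (ι → ℝ) × (ι → A) → ℝ := fun s t ω =>
    k s t ω.1 * ((ω.2.1 s * ω.2.1 t) * (α (ω.2.2 s) * α (ω.2.2 t)))
  have hU : ∀ s t, Integrable (U s t) μ := fun s t =>
    integrable_mul_mul_prod (g := fun _ => 1) (hbbk s t) (integrable_const 1)
      (integrable_eval_mul_eval hαp hαp s t)
  have hV : ∀ s t, Integrable (V s t) μ := fun s t =>
    integrable_mul_mul_prod (hbk s s t) (hνs t) (integrable_eval_mul_eval hαp hα s t)
  have hV' : ∀ s t, Integrable (V' s t) μ := fun s t =>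
    integrable_mul_mul_prod (hbk t s t) (hνs s) (integrable_eval_mul_eval hα hαp s t)
  have hW : ∀ s t, Integrable (W s t) μ := fun s t =>
    integrable_mul_mul_prod (hk s t) (integrable_eval_mul_eval hν hν s t)
      (integrable_eval_mul_eval hα hα s t)
  have hV0 : ∀ s t, ∫ ω, V s t ω ∂μ = 0 := fun s t => by
    refine (integral_mul_mul_prod (fun z => b s z * k s t z) (fun e : ι → ℝ => e t)
      (fun a : ι → A => (α (a s) - p) * α (a t))).trans ?_
    rw [hνs0, zero_mul, mul_zero]
  have hV0' : ∀ s t, ∫ ω, V' s t ω ∂μ = 0 := fun s t => by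
    refine (integral_mul_mul_prod (fun z => b t z * k s t z) (fun e : ι → ℝ => e s)
      (fun a : ι → A => α (a s) * (α (a t) - p))).trans ?_
    rw [hνs0, zero_mul, mul_zero]
  have hWst : ∀ s t, ∫ ω, W s t ω ∂μ =
      if s = t then (∫ a, α a ^ 2 ∂ρ) * (∫ e, e ^ 2 ∂ν) * ∫ z, k t t z ∂ζ else 0 := fun s t => by
    refine (integral_mul_mul_prod (k s t) (fun e : ι → ℝ => e s * e t)
      (fun a : ι → A => α (a s) * α (a t))).trans ?_
    rw [integral_eval_mul_eval h0]
    split_ifs with h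
    · subst h
      simp_rw [← sq]
      rw [integral_comp_eval (μ := fun _ : ι => ρ) (i := s) (f := fun a => α a ^ 2)
        (hα.integrable_sq.aestronglyMeasurable)]
      ring
    · simp
  have hsplit : ∀ ω, ∑ s, ∑ t, w s ω * w t ω * k s t ω.1 =
      ∑ s, ∑ t, U s t ω + ((∑ s, ∑ t, V s t ω + ∑ s, ∑ t, V' s t ω) + ∑ s, ∑ t, W s t ω) :=
    fun ω => by
      simp_rw [← Finset.sum_add_distrib]
      refine Finset.sum_congr rfl fun s _ => Finset.sum_congr rfl fun t _ => ?_
      simp only [w, U, V, V', W]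
      ring
  have hsum : ∀ {F : ι → ι → Ω × (ι → ℝ) × (ι → A) → ℝ}, (∀ s t, Integrable (F s t) μ) →
      Integrable (fun ω => ∑ s, ∑ t, F s t ω) μ := fun hF =>
    integrable_finsetSum _ fun s _ => integrable_finsetSum _ fun t _ => hF s t
  have hsum' : ∀ {F : ι → ι → Ω × (ι → ℝ) × (ι → A) → ℝ}, (∀ s t, Integrable (F s t) μ) →
      ∫ ω, ∑ s, ∑ t, F s t ω ∂μ = ∑ s, ∑ t, ∫ ω, F s t ω ∂μ := fun hF => by
    rw [integral_finsetSum _ fun s _ => integrable_finsetSum _ fun t _ => hF s t]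
    exact Finset.sum_congr rfl fun s _ => integral_finsetSum _ fun t _ => hF s t
  have hU0 : 0 ≤ ∫ ω, ∑ s, ∑ t, U s t ω ∂μ := by
    refine integral_nonneg fun ω => ?_
    refine (hpsd ω.1 fun t => (α (ω.2.2 t) - p) * b t ω.1).trans_eq ?_
    refine Finset.sum_congr rfl fun s _ => Finset.sum_congr rfl fun t _ => ?_
    simp only [U]
    ring
  have hVV : Integrable (fun ω => ∑ s, ∑ t, V s t ω + ∑ s, ∑ t, V' s t ω) μ :=
    (hsum hV).add (hsum hV')
  have hVW : Integrable
      (fun ω => (∑ s, ∑ t, V s t ω + ∑ s, ∑ t, V' s t ω) + ∑ s, ∑ t, W s t ω) μ :=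
    hVV.add (hsum hW)
  simp_rw [hsplit]
  refine ⟨(hsum hU).add hVW, ?_⟩
  rw [integral_add (hsum hU) hVW, integral_add hVV (hsum hW), integral_add (hsum hV) (hsum hV'),
    hsum' hV, hsum' hV', hsum' hW]
  simp_rw [hV0, hV0', hWst]
  simpa [Finset.mul_sum] using hU0

end Product

theorem Measurable.matrix_dotProduct {ι X : Type*} [Fintype ι] [MeasurableSpace X]
    {v w : X → ι → ℝ} (hv : ∀ i, Measurable fun x => v x i) (hw : ∀ i, Measurable fun x => w x i) :
    Measurable fun x => v x ⬝ᵥ w x :=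
  Finset.measurable_fun_sum _ fun i _ => (hv i).mul (hw i)

theorem Measurable.matrix_mulVec_apply {ι X : Type*} [Fintype ι] [MeasurableSpace X]
    {M : X → Matrix ι ι ℝ} {v : X → ι → ℝ} (hM : ∀ i j, Measurable fun x => M x i j)
    (hv : ∀ i, Measurable fun x => v x i) (i : ι) : Measurable fun x => (M x *ᵥ v x) i :=
  Measurable.matrix_dotProduct (hM i) hv

theorem sum_sum_mul_dotProduct {ι κ : Type*} [Fintype ι] [Fintype κ] (c : ι → ℝ)
    (B : ι → κ → ℝ) :
    ∑ s, ∑ t, c s * c t * (B s ⬝ᵥ B t) = (∑ t, c t • B t) ⬝ᵥ ∑ t, c t • B t := by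
  simp_rw [sum_dotProduct, dotProduct_sum, smul_dotProduct, dotProduct_smul, smul_eq_mul, mul_assoc]

theorem sum_vecMulVec_mulVec {ι κ : Type*} [Fintype ι] [Fintype κ] (z : ι → κ → ℝ)
    (x : κ → ℝ) :
    (∑ t, vecMulVec (z t) (z t)) *ᵥ x = ∑ t, (x ⬝ᵥ z t) • z t := by
  simp_rw [Matrix.sum_mulVec, vecMulVec_mulVec, dotProduct_comm x]
  simp

/-- The inner product of the `s`-th and `t`-th least-squares weight vectors `S⁻¹ z_s`. -/
def olsKernel (s t : Fin n) (Z : Fin n → Fin d → ℝ) : ℝ :=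
  ((∑ r, vecMulVec (Z r) (Z r))⁻¹ *ᵥ Z s) ⬝ᵥ ((∑ r, vecMulVec (Z r) (Z r))⁻¹ *ᵥ Z t)

theorem measurable_olsKernel (s t : Fin n) : Measurable (olsKernel (d := d) s t) := by
  have h : ∀ r j, Measurable fun Z : Fin n → Fin d → ℝ =>
      ((∑ t, vecMulVec (Z t) (Z t))⁻¹ *ᵥ Z r) j := fun r =>
    Measurable.matrix_mulVec_apply measurable_inv_sum_vecMulVec_apply fun k => by fun_prop
  exact Measurable.matrix_dotProduct (h s) (h t)

theorem sum_sum_mul_olsKernel_nonneg (Z : Fin n → Fin d → ℝ) (c : Fin n → ℝ) :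
    0 ≤ ∑ s, ∑ t, c s * c t * olsKernel s t Z := by
  simp_rw [olsKernel, sum_sum_mul_dotProduct]
  exact dotProduct_self_star_nonneg _

theorem sum_olsKernel_self {Z : Fin n → Fin d → ℝ} (hZ : (∑ t, vecMulVec (Z t) (Z t)).PosDef) :
    ∑ t, olsKernel t t Z = (∑ t, vecMulVec (Z t) (Z t))⁻¹.trace := by
  set S := ∑ t, vecMulVec (Z t) (Z t) with hS
  have hsymm : (S⁻¹)ᵀ = S⁻¹ := by
    simpa using hZ.inv.isHermitian.eq
  have hk : ∀ t, olsKernel t t Z = (S⁻¹ * S⁻¹ * vecMulVec (Z t) (Z t)).trace := fun t => by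
    rw [olsKernel, ← hS, mul_vecMulVec, trace_vecMulVec, ← mulVec_mulVec, dotProduct_comm _ (Z t),
      dotProduct_mulVec (Z t), ← mulVec_transpose, hsymm]
  simp_rw [hk]
  rw [← trace_sum, ← Finset.mul_sum, ← hS, mul_assoc,
    nonsing_inv_mul _ ((isUnit_iff_isUnit_det _).1 hZ.isUnit), mul_one]

theorem abs_olsKernel_le {Z : Fin n → Fin d → ℝ} (hZ : (∑ t, vecMulVec (Z t) (Z t)).PosDef)
    (s t : Fin n) : |olsKernel s t Z| ≤ (∑ t, vecMulVec (Z t) (Z t))⁻¹.trace := by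
  have hnn : ∀ r, 0 ≤ olsKernel r r Z := fun r => dotProduct_self_star_nonneg _
  have hle : ∀ r, olsKernel r r Z ≤ (∑ t, vecMulVec (Z t) (Z t))⁻¹.trace := fun r => by
    rw [← sum_olsKernel_self hZ]
    exact Finset.single_le_sum (fun r _ => hnn r) (Finset.mem_univ r)
  have hcs : olsKernel s t Z ^ 2 ≤ olsKernel s s Z * olsKernel t t Z := by
    simp only [olsKernel, dotProduct, ← sq]
    exact Finset.sum_mul_sq_le_sq_mul_sq _ _ _
  exact abs_le_of_sq_le_sq (hcs.trans (by
    rw [sq]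
    exact mul_le_mul (hle s) (hle t) (hnn t) ((hnn s).trans (hle s)))) ((hnn s).trans (hle s))

theorem integrable_mul_olsKernel (h : d + 2 ≤ n) {f : (Fin n → Fin d → ℝ) → ℝ}
    (hf : Measurable f) {M : ℝ} (hM : ∀ Z, |f Z| ≤ M * Real.exp (1 / 4 * ∑ k, ∑ t, Z t k ^ 2))
    (s t : Fin n) :
    Integrable (fun Z => f Z * olsKernel s t Z) (Measure.pi fun _ => stdGaussianPi d) := by
  refine Integrable.mono' ((integrable_exp_mul_trace_inv_sum_vecMulVec h
    (κ := 1 / 4) (by norm_num)).const_mul M)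
    (hf.mul (measurable_olsKernel s t)).aestronglyMeasurable ?_
  filter_upwards [ae_posDef_sum_vecMulVec (by lia)] with Z hZ
  rw [Real.norm_eq_abs, abs_mul, ← mul_assoc]
  exact mul_le_mul (hM Z) (abs_olsKernel_le hZ s t) (abs_nonneg _) ((abs_nonneg _).trans (hM Z))

theorem sq_dotProduct_le (β : Fin d → ℝ) (Z : Fin n → Fin d → ℝ) (t : Fin n) :
    (β ⬝ᵥ Z t) ^ 2 ≤ 4 * (∑ k, β k ^ 2) * Real.exp (1 / 4 * ∑ k, ∑ t, Z t k ^ 2) := by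
  have h1 : (β ⬝ᵥ Z t) ^ 2 ≤ (∑ k, β k ^ 2) * ∑ k, Z t k ^ 2 :=
    Finset.sum_mul_sq_le_sq_mul_sq _ _ _
  have h2 : ∑ k, Z t k ^ 2 ≤ ∑ k, ∑ t, Z t k ^ 2 := Finset.sum_le_sum fun k _ =>
    Finset.single_le_sum (f := fun t => Z t k ^ 2) (fun _ _ => sq_nonneg _) (Finset.mem_univ t)
  have h3 := Real.add_one_le_exp (1 / 4 * ∑ k, ∑ t, Z t k ^ 2)
  have h4 : 0 ≤ ∑ k, β k ^ 2 := Finset.sum_nonneg fun _ _ => sq_nonneg _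
  nlinarith

theorem integral_sum_olsKernel_self (h : d + 2 ≤ n) :
    ∑ t, ∫ Z, olsKernel t t Z ∂(Measure.pi fun _ : Fin n => stdGaussianPi d) =
      d / ((n : ℝ) - d - 1) := by
  rw [← integral_trace_inv_sum_vecMulVec h, ← integral_finsetSum _ fun t _ => ?_]
  · refine integral_congr_ae ?_
    filter_upwards [ae_posDef_sum_vecMulVec (by lia)] with Z hZ using sum_olsKernel_self hZ
  · simpa using integrable_mul_olsKernel h (f := fun _ => 1) (by fun_prop) (M := 1)
      (fun Z => by
        rw [abs_one, one_mul]
        exact Real.one_le_exp (by positivity)) t t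

theorem excessRisk_thetaBU_mulVec {A : Matrix (Fin d) (Fin d) ℝ} (hA : IsUnit A.det)
    (θ₀ : Fin d → ℝ) (i : Fin K) (q : ℝ) {ω : HierOmega d n K}
    (hS : (∑ t, vecMulVec (ω.1 t) (ω.1 t)).PosDef) :
    let w : Fin n → ℝ := fun t => (ω.2.2 t i - q) * ((Aᵀ *ᵥ θ₀) ⬝ᵥ ω.1 t) + ω.2.2 t i * ω.2.1 t
    excessRisk (A * Aᵀ) (q • θ₀) (thetaBU θ₀ i (Prod.map (fun Z t => A *ᵥ Z t) id ω)) =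
      ∑ s, ∑ t, w s * w t * olsKernel s t ω.1 := by
  intro w
  obtain ⟨Z, η, a⟩ := ω
  simp only at hS w
  set S := ∑ t, vecMulVec (Z t) (Z t) with hSdef
  have hSdet := (isUnit_iff_isUnit_det _).1 hS.isUnit
  have hAt : IsUnit Aᵀ.det := by rwa [det_transpose]
  have hSmat : Smat (n := n) (K := K) (Prod.map (fun Z t => A *ᵥ Z t) id (Z, η, a)) =
      A * S * Aᵀ := by
    simp [Smat, hSdef, Finset.mul_sum, Finset.sum_mul, mul_vecMulVec, vecMulVec_mul,
      vecMul_transpose]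
  have hy : ∀ t, yChild θ₀ i t (Prod.map (fun Z t => A *ᵥ Z t) id (Z, η, a)) =
      a t i * ((Aᵀ *ᵥ θ₀) ⬝ᵥ Z t + η t) := fun t => by
    simp [yChild, yRoot, dotProduct_mulVec, mulVec_transpose]
  have hθ : Aᵀ *ᵥ thetaBU θ₀ i (Prod.map (fun Z t => A *ᵥ Z t) id (Z, η, a)) =
      S⁻¹ *ᵥ ∑ t, (a t i * ((Aᵀ *ᵥ θ₀) ⬝ᵥ Z t + η t)) • Z t := by
    have hsum : ∑ t, (a t i * ((Aᵀ *ᵥ θ₀) ⬝ᵥ Z t + η t)) • A *ᵥ Z t =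
        A *ᵥ ∑ t, (a t i * ((Aᵀ *ᵥ θ₀) ⬝ᵥ Z t + η t)) • Z t := by
      simp_rw [mulVec_sum, mulVec_smul]
    rw [thetaBU, hSmat]
    simp_rw [hy]
    simp only [Prod.map_fst]
    rw [hsum, mulVec_mulVec, mulVec_mulVec, Matrix.mul_inv_rev, Matrix.mul_inv_rev]
    congr 1
    rw [mul_nonsing_inv_cancel_left _ _ hAt, mul_assoc, nonsing_inv_mul _ hA, mul_one]
  have hβ : Aᵀ *ᵥ θ₀ = S⁻¹ *ᵥ ∑ t, ((Aᵀ *ᵥ θ₀) ⬝ᵥ Z t) • Z t := by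
    rw [← sum_vecMulVec_mulVec, mulVec_mulVec, nonsing_inv_mul _ hSdet, one_mulVec]
  have hδ : Aᵀ *ᵥ (thetaBU θ₀ i (Prod.map (fun Z t => A *ᵥ Z t) id (Z, η, a)) - q • θ₀) =
      ∑ t, w t • S⁻¹ *ᵥ Z t := by
    rw [mulVec_sub, mulVec_smul, hθ]
    nth_rw 2 [hβ]
    rw [← mulVec_smul, ← mulVec_sub, Finset.smul_sum, ← Finset.sum_sub_distrib, mulVec_sum]
    refine Finset.sum_congr rfl fun t _ => ?_
    rw [smul_smul, ← sub_smul, mulVec_smul]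
    congr 1
    simp only [w]
    ring
  simp only [olsKernel, sum_sum_mul_dotProduct]
  rw [← hSdef, ← hδ, excessRisk, ← mulVec_mulVec, dotProduct_mulVec, ← mulVec_transpose]

theorem measurable_excessRisk_thetaBU (C : Matrix (Fin d) (Fin d) ℝ) (θ₀ tgt : Fin d → ℝ)
    (i : Fin K) :
    Measurable fun ω : HierOmega d n K => excessRisk C tgt (thetaBU θ₀ i ω) := by
  have hS : ∀ j k, Measurable fun ω : HierOmega d n K => (Smat ω)⁻¹ j k := fun j k =>
    (measurable_inv_sum_vecMulVec_apply j k).comp measurable_fst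
  have hy : ∀ t, Measurable fun ω : HierOmega d n K => yChild θ₀ i t ω := fun t =>
    have hx : Measurable fun ω : HierOmega d n K => θ₀ ⬝ᵥ ω.1 t :=
      Measurable.matrix_dotProduct (fun _ => measurable_const) fun k => by fun_prop
    Measurable.mul (by fun_prop) (hx.add (by fun_prop))
  have hθ : ∀ j, Measurable fun ω : HierOmega d n K => thetaBU θ₀ i ω j :=
    Measurable.matrix_mulVec_apply hS fun k => by
      simp only [Finset.sum_apply, Pi.smul_apply, smul_eq_mul]
      exact Finset.measurable_fun_sum _ fun t _ => (hy t).mul (by fun_prop)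
  have hsub : ∀ j, Measurable fun ω : HierOmega d n K => (thetaBU θ₀ i ω - tgt) j :=
    fun j => (hθ j).sub_const _
  exact Measurable.matrix_dotProduct hsub
    (Measurable.matrix_mulVec_apply (fun _ _ => measurable_const) hsub)

theorem measurable_mulVec_prodMap {Y : Type*} [MeasurableSpace Y]
    (A : Matrix (Fin d) (Fin d) ℝ) :
    Measurable (Prod.map (fun (Z : Fin n → Fin d → ℝ) t => A *ᵥ Z t) (id : Y → Y)) := by
  have hA : Measurable fun z => A *ᵥ z := (continuous_const.matrix_mulVec continuous_id).measurable
  fun_prop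

theorem hierMeasure_map_mulVec (A : Matrix (Fin d) (Fin d) ℝ) (νη : Measure ℝ)
    (νa : Measure (Fin K → ℝ)) [IsProbabilityMeasure νη] [IsProbabilityMeasure νa] :
    hierMeasure d n K ((stdGaussianPi d).map fun z => A.mulVec z) νη νa =
      (hierMeasure d n K (stdGaussianPi d) νη νa).map (Prod.map (fun Z t => A *ᵥ Z t) id) := by
  have hA : Measurable fun z => A *ᵥ z := (continuous_const.matrix_mulVec continuous_id).measurable
  have := Measure.isProbabilityMeasure_map (μ := stdGaussianPi d) hA.aemeasurable
  rw [hierMeasure, ← Measure.pi_map_pi fun _ => hA.aemeasurable, hierMeasure,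
    ← Measure.map_prod_map _ _ (by fun_prop) measurable_id, Measure.map_id]
/-- In the two-level hierarchical linear regression model, for each
individual child node `i`, the expected excess risk of the bottom-up OLS estimator
satisfies `E[r_i(θ̂ᵇ_i)] ≥ (s_i + p_i²) · σ² · d/(n−d−1)`. -/
theorem bottomUp_child_excess_risk_lower_bound
    (d n K : ℕ) (hd : 1 ≤ d) (hn : d + 2 ≤ n)
    (C : Matrix (Fin d) (Fin d) ℝ) (hC : C.PosDef)
    (θ₀ : Fin d → ℝ) (σ : ℝ)
    (νx : Measure (Fin d → ℝ)) (νη : Measure ℝ) (νa : Measure (Fin K → ℝ))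
    [IsProbabilityMeasure νη] [IsProbabilityMeasure νa]
    (hx : IsCenteredGaussian νx C)
    (hηmean : ∫ e, e ∂νη = 0)
    (hηvar : ∫ e, e ^ 2 ∂νη = σ ^ 2)
    (p s : Fin K → ℝ)
    (hamean : ∀ i, ∫ v, v i ∂νa = p i)
    (havar : ∀ i, ∫ v, (v i - p i) ^ 2 ∂νa = s i)
    (habdd : ∃ M : ℝ, ∀ᵐ v ∂νa, ∀ i, |v i| ≤ M)
    (i : Fin K) :
    (s i + p i ^ 2) * σ ^ 2 * d / ((n : ℝ) - d - 1) ≤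
      ∫ ω, excessRisk C (p i • θ₀) (thetaBU θ₀ i ω)
        ∂(hierMeasure d n K νx νη νa) := by
  obtain ⟨A, rfl, rfl⟩ := hx
  have hA : IsUnit A.det := by
    have h := (isUnit_iff_isUnit_det _).1 hC.isUnit
    rw [det_mul] at h
    exact isUnit_of_mul_isUnit_left h
  obtain rfl | hσ := eq_or_ne σ 0
  · have h : 0 ≤ ∫ ω, excessRisk (A * Aᵀ) (p i • θ₀) (thetaBU θ₀ i ω)
        ∂(hierMeasure d n K ((stdGaussianPi d).map fun z => A.mulVec z) νη νa) :=
      integral_nonneg fun ω => hC.posSemidef.dotProduct_mulVec_nonneg _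
    simpa using h
  have hη : MemLp (fun e : ℝ => e) 2 νη := by
    refine (memLp_two_iff_integrable_sq measurable_id.aestronglyMeasurable).2 ?_
    by_contra h
    exact pow_ne_zero 2 hσ (hηvar.symm.trans (integral_undef h))
  obtain ⟨M, hM⟩ := habdd
  have ha : MemLp (fun v : Fin K → ℝ => v i) 2 νa :=
    MemLp.of_bound (measurable_pi_apply i).aestronglyMeasurable M (by
      filter_upwards [hM] with v hv using hv i)
  have hasq : ∫ v, v i ^ 2 ∂νa = s i + p i ^ 2 := by
    rw [integral_sq_eq_integral_sub_sq_add ha (hamean i), havar]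
  set β := Aᵀ *ᵥ θ₀
  set B := ∑ k, β k ^ 2
  have hB : 0 ≤ B := Finset.sum_nonneg fun _ _ => sq_nonneg _
  have hexp : ∀ Z : Fin n → Fin d → ℝ, 1 ≤ Real.exp (1 / 4 * ∑ k, ∑ t, Z t k ^ 2) :=
    fun Z => Real.one_le_exp (by positivity)
  have hbm : ∀ t, Measurable fun Z : Fin n → Fin d → ℝ => β ⬝ᵥ Z t := fun t =>
    Measurable.matrix_dotProduct (fun _ => measurable_const) fun k => by fun_prop
  have hmain := (integrable_and_le_integral_quadratic_form (ζ := Measure.pi fun _ => stdGaussianPi d)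
    (ν := νη) (ρ := νa) (α := fun v => v i) (p := p i) (b := fun t Z => β ⬝ᵥ Z t)
    (k := olsKernel (n := n))
    (fun s t => by
      simpa using integrable_mul_olsKernel hn (f := fun _ => 1) measurable_const (M := 1)
        (fun Z => by simpa using hexp Z) s t)
    (fun r s t => integrable_mul_olsKernel hn (hbm r) (M := 1 + 4 * B)
      (fun Z => abs_le.2 (by
        have := sq_dotProduct_le β Z r
        have := hexp Z
        constructor <;> nlinarith [sq_nonneg (β ⬝ᵥ Z r - 1), sq_nonneg (β ⬝ᵥ Z r + 1)])) s t)
    (fun s t => integrable_mul_olsKernel hn (f := fun Z => (β ⬝ᵥ Z s) * (β ⬝ᵥ Z t))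
      ((hbm s).mul (hbm t)) (M := 4 * B)
      (fun Z => abs_le.2 (by
        have := sq_dotProduct_le β Z s
        have := sq_dotProduct_le β Z t
        constructor <;> nlinarith [sq_nonneg (β ⬝ᵥ Z s - β ⬝ᵥ Z t),
          sq_nonneg (β ⬝ᵥ Z s + β ⬝ᵥ Z t)])) s t)
    sum_sum_mul_olsKernel_nonneg hη hηmean ha).2
  rw [hasq, hηvar, integral_sum_olsKernel_self hn, ← mul_div_assoc] at hmain
  refine hmain.trans_eq ?_
  rw [hierMeasure_map_mulVec, integral_map (Measurable.aemeasurable ?_)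
    (measurable_excessRisk_thetaBU _ _ _ _).aestronglyMeasurable]
  · refine integral_congr_ae ?_
    have hS : ∀ᵐ ω ∂hierMeasure d n K (stdGaussianPi d) νη νa,
        (∑ t, vecMulVec (ω.1 t) (ω.1 t)).PosDef :=
      Measure.quasiMeasurePreserving_fst.ae (ae_posDef_sum_vecMulVec (by lia))
    filter_upwards [hS] with ω hω
    exact (excessRisk_thetaBU_mulVec hA θ₀ i (p i) hω).symm
  · exact measurable_mulVec_prodMap A

end
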